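/- arXiv:2111.07784 — 2 statements merged into one kernel-verified Lean document; each statement's English description precedes it below -/
import Mathlib

section
/- The map φ ↦ ρ(φ,1)/E(φ,1)^{3/5} is strictly monotone (strictly increasing) on ℝ. -/
noncomputable section

/-- Three-dimensional Euclidean velocity space. -/
abbrev V3 := EuclideanSpace ℝ (Fin 3)

/-- `ρ(φ,T) = T^{3/2} ∫_{ℝ³} (1 + e^{|v|²/2 − φ})⁻¹ dv`. -/
def rhoFD (φ T : ℝ) : ℝ :=
  T ^ ((3 : ℝ) / 2) * ∫ v : V3, (1 + Real.exp (‖v‖ ^ 2 / 2 - φ))⁻¹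

/-- `E(φ,T) = (1/3) T^{5/2} ∫_{ℝ³} |v|² (1 + e^{|v|²/2 − φ})⁻¹ dv`. -/
def EFD (φ T : ℝ) : ℝ :=
  (1 / 3) * T ^ ((5 : ℝ) / 2) * ∫ v : V3, ‖v‖ ^ 2 * (1 + Real.exp (‖v‖ ^ 2 / 2 - φ))⁻¹

open MeasureTheory

/-- The Fermi–Dirac profile `(1 + e^{|v|²/2 − φ})⁻¹`. -/
def fermi (φ : ℝ) (v : V3) : ℝ := (1 + Real.exp (‖v‖ ^ 2 / 2 - φ))⁻¹

lemma fermi_pos (φ : ℝ) (v : V3) : 0 < fermi φ v := by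
  unfold fermi; positivity

lemma continuous_fermi (φ : ℝ) : Continuous (fermi φ) := by
  unfold fermi
  exact Continuous.inv₀ (by fun_prop) fun v => by positivity

lemma fermi_le_exp (φ : ℝ) (v : V3) :
    fermi φ v ≤ Real.exp φ * Real.exp (-(1 / 2) * ‖v‖ ^ 2) := by
  unfold fermi
  rw [← Real.exp_add, show φ + -(1 / 2) * ‖v‖ ^ 2 = -(‖v‖ ^ 2 / 2 - φ) by ring, Real.exp_neg]
  exact inv_anti₀ (Real.exp_pos _) (by linarith)

lemma integrable_exp_neg_mul_sq_norm {b : ℝ} (hb : 0 < b) :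
    Integrable (fun v : V3 => Real.exp (-b * ‖v‖ ^ 2)) := by
  have h := (GaussianFourier.integrable_cexp_neg_mul_sq_norm_add (V := V3) (b := (b : ℂ))
    (by simpa using hb) 0 0).norm
  refine h.congr (Filter.Eventually.of_forall fun v => ?_)
  simp [Complex.norm_exp, ← Complex.ofReal_pow]

lemma integrable_fermi (φ : ℝ) : Integrable (fermi φ) := by
  refine ((integrable_exp_neg_mul_sq_norm (b := 1 / 2) (by norm_num)).const_mul
    (Real.exp φ)).mono' (continuous_fermi φ).aestronglyMeasurable
    (Filter.Eventually.of_forall fun v => ?_)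
  rw [Real.norm_of_nonneg (fermi_pos φ v).le]
  exact fermi_le_exp φ v

lemma integrable_sq_norm_mul_fermi (φ : ℝ) :
    Integrable (fun v : V3 => ‖v‖ ^ 2 * fermi φ v) := by
  refine ((integrable_exp_neg_mul_sq_norm (b := 1 / 4) (by norm_num)).const_mul
    (4 * Real.exp φ)).mono'
    ((continuous_norm.pow 2).mul (continuous_fermi φ)).aestronglyMeasurable
    (Filter.Eventually.of_forall fun v => ?_)
  rw [Real.norm_of_nonneg (mul_nonneg (sq_nonneg _) (fermi_pos φ v).le)]
  have h₁ : ‖v‖ ^ 2 ≤ 4 * Real.exp (1 / 4 * ‖v‖ ^ 2) := by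
    linarith [Real.add_one_le_exp (1 / 4 * ‖v‖ ^ 2)]
  calc ‖v‖ ^ 2 * fermi φ v
      ≤ (4 * Real.exp (1 / 4 * ‖v‖ ^ 2)) * (Real.exp φ * Real.exp (-(1 / 2) * ‖v‖ ^ 2)) :=
        mul_le_mul h₁ (fermi_le_exp φ v) (fermi_pos φ v).le (by positivity)
    _ = 4 * Real.exp φ * (Real.exp (1 / 4 * ‖v‖ ^ 2) * Real.exp (-(1 / 2) * ‖v‖ ^ 2)) := by ring
    _ = 4 * Real.exp φ * Real.exp (-(1 / 4) * ‖v‖ ^ 2) := by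
        rw [← Real.exp_add]; ring_nf

lemma fermi_lt_fermi {φ ψ : ℝ} {v w : V3} (h : ‖w‖ ^ 2 / 2 - ψ < ‖v‖ ^ 2 / 2 - φ) :
    fermi φ v < fermi ψ w := by
  unfold fermi
  exact inv_strictAnti₀ (by positivity) (by gcongr)

lemma fermi_le_fermi {φ ψ : ℝ} {v w : V3} (h : ‖w‖ ^ 2 / 2 - ψ ≤ ‖v‖ ^ 2 / 2 - φ) :
    fermi φ v ≤ fermi ψ w := by
  unfold fermi
  exact inv_anti₀ (by positivity) (by gcongr)

lemma integral_fermi_pos (φ : ℝ) : 0 < ∫ v, fermi φ v :=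
  integral_pos_of_integrable_nonneg_nonzero (x := 0) (continuous_fermi φ) (integrable_fermi φ)
    (fun v => (fermi_pos φ v).le) (fermi_pos φ 0).ne'

lemma exists_norm_eq_one : ∃ e : V3, ‖e‖ = 1 :=
  ⟨EuclideanSpace.single 0 1, by simp⟩

lemma integral_sq_norm_mul_fermi_pos (φ : ℝ) : 0 < ∫ v : V3, ‖v‖ ^ 2 * fermi φ v := by
  obtain ⟨e, he⟩ := exists_norm_eq_one
  refine integral_pos_of_integrable_nonneg_nonzero (x := e)
    ((continuous_norm.pow 2).mul (continuous_fermi φ)) (integrable_sq_norm_mul_fermi φ)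
    (fun v => mul_nonneg (sq_nonneg _) (fermi_pos φ v).le) ?_
  simpa [he] using (fermi_pos φ e).ne'

lemma integral_sq_norm_mul_fermi_strictMono :
    StrictMono (fun φ : ℝ => ∫ v : V3, ‖v‖ ^ 2 * fermi φ v) := by
  intro φ ψ h
  obtain ⟨e, he⟩ := exists_norm_eq_one
  have key : 0 < ∫ v : V3, (‖v‖ ^ 2 * fermi ψ v - ‖v‖ ^ 2 * fermi φ v) := by
    refine integral_pos_of_integrable_nonneg_nonzero (x := e)
      (((continuous_norm.pow 2).mul (continuous_fermi ψ)).sub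
        ((continuous_norm.pow 2).mul (continuous_fermi φ)))
      ((integrable_sq_norm_mul_fermi ψ).sub (integrable_sq_norm_mul_fermi φ))
      (fun v => sub_nonneg.2 (mul_le_mul_of_nonneg_left (fermi_le_fermi (by linarith))
        (sq_nonneg _))) ?_
    have : fermi φ e < fermi ψ e := fermi_lt_fermi (by linarith)
    simpa [he] using (sub_pos.2 this).ne'
  rw [integral_sub (integrable_sq_norm_mul_fermi ψ) (integrable_sq_norm_mul_fermi φ)] at key
  exact sub_pos.1 key

/-- If dilating the profile with parameter `φ` by a factor `s < 1` gives it the same energy as the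
profile with the larger parameter `ψ`, then the dilated profile has the smaller mass. The two
profiles cross exactly once in `‖v‖`. -/
lemma integral_fermi_dilation_lt {φ ψ s : ℝ} (h : φ < ψ) (hs₀ : 0 < s) (hs₁ : s < 1)
    (hE : ∫ v : V3, ‖v‖ ^ 2 * fermi φ v = s ^ 5 * ∫ v : V3, ‖v‖ ^ 2 * fermi ψ v) :
    ∫ v, fermi φ v < s ^ 3 * ∫ v, fermi ψ v := by
  have hsq : 0 < 1 - s ^ 2 := by nlinarith
  set c : ℝ := 2 * (ψ - φ) / (1 - s ^ 2) with hc
  have hc₀ : 0 < c := div_pos (by linarith) hsq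
  have hc₁ : c * (1 - s ^ 2) = 2 * (ψ - φ) := div_mul_cancel₀ _ hsq.ne'
  have norm_dil (v : V3) : ‖s • v‖ ^ 2 = s ^ 2 * ‖v‖ ^ 2 := by
    rw [norm_smul, mul_pow, Real.norm_eq_abs, sq_abs]
  have int₀ : Integrable (fun v : V3 => fermi φ (s • v)) :=
    (integrable_fermi φ).comp_smul hs₀.ne'
  have eq₂ (v : V3) : ‖v‖ ^ 2 * fermi φ (s • v)
      = (s ^ 2)⁻¹ * (‖s • v‖ ^ 2 * fermi φ (s • v)) := by
    rw [norm_dil]; field_simp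
  have int₂ : Integrable (fun v : V3 => ‖v‖ ^ 2 * fermi φ (s • v)) := by
    simp_rw [eq₂]
    exact ((integrable_sq_norm_mul_fermi φ).comp_smul hs₀.ne').const_mul _
  have dil (F : V3 → ℝ) : ∫ v, F (s • v) = (s ^ 3)⁻¹ * ∫ v, F v := by
    rw [Measure.integral_comp_smul_of_nonneg volume F s (hR := hs₀.le)]
    simp
  have val₀ : ∫ v, fermi φ (s • v) = (s ^ 3)⁻¹ * ∫ v, fermi φ v := dil _
  have val₂ : ∫ v : V3, ‖v‖ ^ 2 * fermi φ (s • v) = ∫ v : V3, ‖v‖ ^ 2 * fermi ψ v := by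
    simp_rw [eq₂]
    rw [integral_const_mul, dil (fun v => ‖v‖ ^ 2 * fermi φ v), hE]
    field_simp
  have sub₀ : Integrable (fun v : V3 => c * (fermi ψ v - fermi φ (s • v))) :=
    ((integrable_fermi ψ).sub int₀).const_mul c
  have sub₂ : Integrable (fun v : V3 => ‖v‖ ^ 2 * fermi ψ v - ‖v‖ ^ 2 * fermi φ (s • v)) :=
    (integrable_sq_norm_mul_fermi ψ).sub int₂
  have pos : 0 < ∫ v : V3, (c * (fermi ψ v - fermi φ (s • v))
      - (‖v‖ ^ 2 * fermi ψ v - ‖v‖ ^ 2 * fermi φ (s • v))) := by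
    have c₁ := continuous_fermi ψ
    have c₂ : Continuous fun v : V3 => fermi φ (s • v) :=
      (continuous_fermi φ).comp (continuous_const_smul s)
    refine integral_pos_of_integrable_nonneg_nonzero (x := 0) (by fun_prop)
      (sub₀.sub sub₂) (fun v => ?_) ?_
    · have fac : c * (fermi ψ v - fermi φ (s • v))
          - (‖v‖ ^ 2 * fermi ψ v - ‖v‖ ^ 2 * fermi φ (s • v))
          = (c - ‖v‖ ^ 2) * (fermi ψ v - fermi φ (s • v)) := by ring
      simp only [Pi.zero_apply, fac]
      rcases le_total (‖v‖ ^ 2) c with hv | hv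
      · refine mul_nonneg (sub_nonneg.2 hv) (sub_nonneg.2 (fermi_le_fermi ?_))
        rw [norm_dil]; nlinarith
      · refine mul_nonneg_of_nonpos_of_nonpos (sub_nonpos.2 hv)
          (sub_nonpos.2 (fermi_le_fermi ?_))
        rw [norm_dil]; nlinarith
    · have : fermi φ (0 : V3) < fermi ψ 0 := fermi_lt_fermi (by linarith)
      simpa using ⟨hc₀.ne', (sub_pos.2 this).ne'⟩
  rw [integral_sub sub₀ sub₂, integral_const_mul,
    integral_sub (integrable_fermi ψ) int₀, integral_sub (integrable_sq_norm_mul_fermi ψ) int₂,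
    val₂, sub_self, sub_zero, val₀] at pos
  have := sub_pos.1 (pos_of_mul_pos_right pos hc₀.le)
  rwa [inv_mul_lt_iff₀ (by positivity)] at this

/-- the map `φ ↦ ρ(φ,1)/E(φ,1)^{3/5}` is strictly increasing on `ℝ`. -/
theorem strictMono_rho_over_E_rpow :
    StrictMono (fun φ : ℝ => rhoFD φ 1 / EFD φ 1 ^ ((3 : ℝ) / 5)) := by
  intro φ ψ h
  have hφ := integral_sq_norm_mul_fermi_pos φ
  have hψ := integral_sq_norm_mul_fermi_pos ψ
  have hlt : ∫ v : V3, ‖v‖ ^ 2 * fermi φ v < ∫ v : V3, ‖v‖ ^ 2 * fermi ψ v :=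
    integral_sq_norm_mul_fermi_strictMono h
  have hρ (χ : ℝ) : rhoFD χ 1 = ∫ v, fermi χ v := by simp [rhoFD, fermi]
  have hE (χ : ℝ) : EFD χ 1 = 1 / 3 * ∫ v : V3, ‖v‖ ^ 2 * fermi χ v := by simp [EFD, fermi]
  simp only [hρ, hE]
  set A := ∫ v : V3, ‖v‖ ^ 2 * fermi φ v
  set B := ∫ v : V3, ‖v‖ ^ 2 * fermi ψ v
  have hq : 0 < A / B := div_pos hφ hψ
  have s₅ : ((A / B) ^ ((1 : ℝ) / 5)) ^ 5 = A / B := by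
    rw [← Real.rpow_mul_natCast hq.le]; norm_num
  have s₃ : ((A / B) ^ ((1 : ℝ) / 5)) ^ 3 = (A / B) ^ ((3 : ℝ) / 5) := by
    rw [← Real.rpow_mul_natCast hq.le]; norm_num
  have key := integral_fermi_dilation_lt h (Real.rpow_pos_of_pos hq ((1 : ℝ) / 5))
    (Real.rpow_lt_one hq.le ((div_lt_one hψ).2 hlt) (by norm_num))
    (by rw [s₅]; exact (div_mul_cancel₀ _ hψ.ne').symm)
  rw [s₃, Real.div_rpow hφ.le hψ.le, div_mul_eq_mul_div,
    lt_div_iff₀ (Real.rpow_pos_of_pos hψ _)] at key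
  rw [Real.mul_rpow (by norm_num) hφ.le, Real.mul_rpow (by norm_num) hψ.le,
    div_lt_div_iff₀ (by positivity) (by positivity)]
  have h₃ : (0 : ℝ) < (1 / 3) ^ ((3 : ℝ) / 5) := by positivity
  nlinarith [mul_lt_mul_of_pos_left key h₃]
end
end

section
/- Let J = (8√2 π/3)^{2/5} (5/2)^{3/5} and let varphi(φ) = ρ(φ,1)/E(φ,1)^{3/5}. Then 0 < varphi(φ) < J for every φ ∈ ℝ, varphi(φ) → 0 as φ → −∞, and varphi(φ) → J as φ → +∞. -/
open Filter

noncomputable section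

/-- The constant `J = (8√2 π/3)^{2/5} (5/2)^{3/5}`. -/
def Jconst : ℝ :=
  (8 * Real.sqrt 2 * Real.pi / 3) ^ ((2 : ℝ) / 5) * ((5 : ℝ) / 2) ^ ((3 : ℝ) / 5)

/-- The map `varphi(φ) = ρ(φ,1)/E(φ,1)^{3/5}`. -/
def varphiFD (φ : ℝ) : ℝ := rhoFD φ 1 / EFD φ 1 ^ ((3 : ℝ) / 5)

open MeasureTheory Set

/-- The radial moment `∫₀^∞ yⁿ (1 + e^{y²/2 − φ})⁻¹ dy`. -/
def radialMoment (n : ℕ) (φ : ℝ) : ℝ :=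
  ∫ y in Ioi (0 : ℝ), y ^ n * (1 + Real.exp (y ^ 2 / 2 - φ))⁻¹

/-- The ratio `ρ / E^{3/5}` in terms of the radial moments of orders `2` and `4`. -/
def momentRatio (a b : ℝ) : ℝ :=
  4 * Real.pi * a / (4 * Real.pi / 3 * b) ^ ((3 : ℝ) / 5)

lemma integral_fun_norm_V3 (f : ℝ → ℝ) :
    ∫ v : V3, f ‖v‖ = 4 * Real.pi * ∫ y in Ioi (0 : ℝ), y ^ 2 * f y := by
  have h := integral_fun_norm_addHaar (volume : Measure V3) f
  have hv : (volume : Measure V3).real (Metric.ball 0 1) = Real.pi * 4 / 3 := by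
    rw [measureReal_def, EuclideanSpace.volume_ball_fin_three]
    rw [ENNReal.toReal_mul, ENNReal.toReal_ofReal (by positivity)]
    simp
  rw [h, hv, finrank_euclideanSpace_fin]
  simp only [smul_eq_mul, nsmul_eq_mul]
  push_cast
  ring

lemma varphiFD_eq (φ : ℝ) :
    varphiFD φ = momentRatio (radialMoment 2 φ) (radialMoment 4 φ) := by
  have h2 := integral_fun_norm_V3 fun y => (1 + Real.exp (y ^ 2 / 2 - φ))⁻¹
  have h4 := integral_fun_norm_V3 fun y => y ^ 2 * (1 + Real.exp (y ^ 2 / 2 - φ))⁻¹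
  simp only [← mul_assoc, ← pow_add] at h2 h4
  simp only [varphiFD, rhoFD, EFD, momentRatio, radialMoment, Real.one_rpow, h2, h4]
  rw [show (1 : ℝ) / 3 * 1 * (4 * Real.pi *
      ∫ y in Ioi (0 : ℝ), y ^ (2 + 2) * (1 + Real.exp (y ^ 2 / 2 - φ))⁻¹) = 4 * Real.pi / 3 *
      ∫ y in Ioi (0 : ℝ), y ^ (2 + 2) * (1 + Real.exp (y ^ 2 / 2 - φ))⁻¹ by ring, one_mul]

lemma momentRatio_scale {s a b : ℝ} (hs : 0 < s) (hb : 0 ≤ b) :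
    momentRatio (s ^ 3 * a) (s ^ 5 * b) = momentRatio a b := by
  have hp := Real.pi_pos
  have h : (s ^ 5) ^ ((3 : ℝ) / 5) = s ^ 3 := by
    rw [← Real.rpow_natCast, ← Real.rpow_mul hs.le, ← Real.rpow_natCast]
    norm_num
  rw [momentRatio, momentRatio,
    show 4 * Real.pi / 3 * (s ^ 5 * b) = s ^ 5 * (4 * Real.pi / 3 * b) by ring,
    Real.mul_rpow (by positivity) (by positivity), h,
    show 4 * Real.pi * (s ^ 3 * a) = s ^ 3 * (4 * Real.pi * a) by ring]
  exact mul_div_mul_left _ _ (by positivity)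

lemma momentRatio_ball {R : ℝ} (hR : 0 < R) :
    momentRatio (R ^ 3 / 3) (R ^ 5 / 5) = Jconst := by
  have hp := Real.pi_pos
  rw [div_eq_mul_one_div (R ^ 3), div_eq_mul_one_div (R ^ 5),
    momentRatio_scale hR (by norm_num), momentRatio, Jconst]
  set x := 4 * Real.pi / 3 with hx
  have hx0 : 0 < x := by positivity
  have h8 : 8 * Real.sqrt 2 * Real.pi / 3 = 2 ^ ((3 : ℝ) / 2) * x := by
    have : (2 : ℝ) ^ ((3 : ℝ) / 2) = 2 * Real.sqrt 2 := by
      rw [Real.sqrt_eq_rpow, show (3 : ℝ) / 2 = 1 + 1 / 2 by norm_num,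
        Real.rpow_add (by norm_num), Real.rpow_one]
    rw [this, hx]; ring
  have hxx : 4 * Real.pi * (1 / 3) = x ^ ((2 : ℝ) / 5) * x ^ ((3 : ℝ) / 5) := by
    rw [← Real.rpow_add hx0]; norm_num [hx]; ring
  rw [h8, hxx, Real.mul_rpow (by positivity) hx0.le, Real.mul_rpow hx0.le (by norm_num),
    ← Real.rpow_mul (by norm_num), Real.div_rpow zero_le_one (by norm_num : (0 : ℝ) ≤ 5),
    Real.div_rpow (by norm_num : (0 : ℝ) ≤ 5) zero_le_two,
    Real.one_rpow]
  norm_num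
  field_simp

lemma momentRatio_lt {a b c : ℝ} (ha : 0 < a) (hb : 0 < b) (h : b < c) :
    momentRatio a c < momentRatio a b := by
  have hp := Real.pi_pos
  unfold momentRatio
  gcongr

lemma continuous_fermi_s6 (φ : ℝ) (n : ℕ) :
    Continuous fun y : ℝ => y ^ n * (1 + Real.exp (y ^ 2 / 2 - φ))⁻¹ := by
  refine Continuous.mul (by fun_prop) (Continuous.inv₀ (by fun_prop) fun y => ?_)
  positivity

lemma inv_one_add_exp_le (x : ℝ) : (1 + Real.exp x)⁻¹ ≤ Real.exp (-x) := by
  rw [Real.exp_neg]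
  gcongr
  linarith

lemma integrableOn_pow_mul_gaussian (n : ℕ) :
    IntegrableOn (fun y : ℝ => y ^ n * Real.exp (-(y ^ 2 / 2))) (Ioi 0) := by
  have h := integrableOn_rpow_mul_exp_neg_mul_sq (b := 1 / 2) (by norm_num) (s := n)
    (by linarith [n.cast_nonneg (α := ℝ)])
  refine h.congr_fun (fun y _ => ?_) measurableSet_Ioi
  simp only [Real.rpow_natCast]
  ring_nf

lemma fermi_le_gaussian {y : ℝ} (hy : 0 ≤ y) (φ : ℝ) (n : ℕ) :
    y ^ n * (1 + Real.exp (y ^ 2 / 2 - φ))⁻¹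
      ≤ Real.exp φ * (y ^ n * Real.exp (-(y ^ 2 / 2))) := by
  have h := inv_one_add_exp_le (y ^ 2 / 2 - φ)
  rw [show -(y ^ 2 / 2 - φ) = φ + -(y ^ 2 / 2) by ring, Real.exp_add] at h
  calc _ ≤ y ^ n * (Real.exp φ * Real.exp (-(y ^ 2 / 2))) := by gcongr
    _ = _ := by ring

lemma gaussian_le_fermi {y φ : ℝ} (hy : 0 ≤ y) (hφ : φ ≤ 0) (n : ℕ) :
    Real.exp φ / 2 * (y ^ n * Real.exp (-(y ^ 2 / 2)))
      ≤ y ^ n * (1 + Real.exp (y ^ 2 / 2 - φ))⁻¹ := by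
  have h1 : 1 ≤ Real.exp (y ^ 2 / 2 - φ) := Real.one_le_exp (by nlinarith [sq_nonneg y])
  have h2 : (2 * Real.exp (y ^ 2 / 2 - φ))⁻¹ ≤ (1 + Real.exp (y ^ 2 / 2 - φ))⁻¹ := by
    gcongr
    linarith
  have h3 : Real.exp φ / 2 * Real.exp (-(y ^ 2 / 2)) = (2 * Real.exp (y ^ 2 / 2 - φ))⁻¹ := by
    rw [mul_inv, ← Real.exp_neg, neg_sub, sub_eq_add_neg, Real.exp_add]
    ring
  calc _ = y ^ n * (2 * Real.exp (y ^ 2 / 2 - φ))⁻¹ := by rw [← h3]; ring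
    _ ≤ _ := by gcongr

lemma integrableOn_fermi (φ : ℝ) (n : ℕ) :
    IntegrableOn (fun y : ℝ => y ^ n * (1 + Real.exp (y ^ 2 / 2 - φ))⁻¹) (Ioi 0) := by
  refine ((integrableOn_pow_mul_gaussian n).const_mul (Real.exp φ)).mono'
    (continuous_fermi_s6 φ n).aestronglyMeasurable ?_
  filter_upwards [ae_restrict_mem measurableSet_Ioi] with y hy
  have hy : 0 < y := hy
  rw [Real.norm_of_nonneg (by positivity)]
  exact fermi_le_gaussian hy.le φ n

lemma setIntegral_Ioi_pos {f : ℝ → ℝ} {R : ℝ} (hR : 0 ≤ R) (hf : IntegrableOn f (Ioi 0))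
    (h0 : ∀ y, 0 < y → 0 ≤ f y) (h1 : ∀ y, R < y → 0 < f y) :
    0 < ∫ y in Ioi (0 : ℝ), f y := by
  rw [setIntegral_pos_iff_support_of_nonneg_ae _ hf]
  · refine lt_of_lt_of_le ?_ (measure_mono (s := Ioi R) fun y hy => ?_)
    · simp
    · exact ⟨(h1 y hy).ne', hR.trans_lt hy⟩
  · filter_upwards [ae_restrict_mem measurableSet_Ioi] with y hy
    exact h0 y hy

lemma radialMoment_pos (n : ℕ) (φ : ℝ) : 0 < radialMoment n φ :=
  setIntegral_Ioi_pos le_rfl (integrableOn_fermi φ n) (fun y hy => by positivity)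
    (fun y hy => by positivity)

lemma setIntegral_indicator_pow {R : ℝ} (hR : 0 ≤ R) (n : ℕ) :
    ∫ y in Ioi (0 : ℝ), (Ioc 0 R).indicator (fun y => y ^ n) y = R ^ (n + 1) / (n + 1) := by
  rw [setIntegral_indicator measurableSet_Ioc,
    inter_eq_self_of_subset_right Ioc_subset_Ioi_self,
    ← intervalIntegral.integral_of_le hR, integral_pow]
  simp

lemma integrableOn_indicator_pow (R : ℝ) (n : ℕ) :
    IntegrableOn ((Ioc 0 R).indicator fun y : ℝ => y ^ n) (Ioi 0) := by
  refine Integrable.integrableOn ?_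
  rw [integrable_indicator_iff measurableSet_Ioc]
  exact ((continuous_pow n).integrableOn_Icc).mono_set Ioc_subset_Icc_self

/-- The bathtub principle: among densities with values in `[0, 1]` and given mass, the indicator
of a ball minimises the energy. -/
lemma radialMoment_four_gt {R φ : ℝ} (hR : 0 < R) (h : radialMoment 2 φ = R ^ 3 / 3) :
    R ^ 5 / 5 < radialMoment 4 φ := by
  have hi₁ : IntegrableOn (fun y : ℝ => y ^ 4 * (1 + Real.exp (y ^ 2 / 2 - φ))⁻¹
      - R ^ 2 * (y ^ 2 * (1 + Real.exp (y ^ 2 / 2 - φ))⁻¹)) (Ioi 0) :=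
    (integrableOn_fermi φ 4).sub ((integrableOn_fermi φ 2).const_mul _)
  have hi₂ : IntegrableOn (fun y : ℝ => (Ioc 0 R).indicator (fun y => y ^ 4) y
      - R ^ 2 * (Ioc 0 R).indicator (fun y => y ^ 2) y) (Ioi 0) :=
    (integrableOn_indicator_pow R 4).sub ((integrableOn_indicator_pow R 2).const_mul _)
  have hpos := setIntegral_Ioi_pos hR.le (hi₁.sub hi₂)
    (fun y hy => by
      rw [Pi.sub_apply]
      have hg : (1 + Real.exp (y ^ 2 / 2 - φ))⁻¹ ≤ 1 :=
        inv_le_one_of_one_le₀ (by linarith [Real.exp_pos (y ^ 2 / 2 - φ)])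
      have hg0 : 0 < (1 + Real.exp (y ^ 2 / 2 - φ))⁻¹ := by positivity
      generalize (1 + Real.exp (y ^ 2 / 2 - φ))⁻¹ = g at hg hg0
      by_cases hyR : y ≤ R
      · have : 0 ≤ y ^ 2 * ((R ^ 2 - y ^ 2) * (1 - g)) :=
          mul_nonneg (by positivity)
            (mul_nonneg (sub_nonneg.2 (by gcongr)) (by linarith))
        simp only [indicator_of_mem (show y ∈ Ioc 0 R from ⟨hy, hyR⟩)]
        linarith
      · have : 0 ≤ y ^ 2 * ((y ^ 2 - R ^ 2) * g) :=
          mul_nonneg (by positivity)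
            (mul_nonneg (sub_nonneg.2 (by gcongr; linarith)) hg0.le)
        simp only [indicator_of_notMem (show y ∉ Ioc 0 R from fun h => hyR h.2)]
        linarith)
    (fun y hy => by
      rw [Pi.sub_apply]
      have hg0 : 0 < (1 + Real.exp (y ^ 2 / 2 - φ))⁻¹ := by positivity
      generalize (1 + Real.exp (y ^ 2 / 2 - φ))⁻¹ = g at hg0
      have hy0 : 0 < y := hR.trans hy
      have : 0 < y ^ 2 * ((y ^ 2 - R ^ 2) * g) :=
        mul_pos (by positivity) (mul_pos (sub_pos.2 (by gcongr)) hg0)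
      simp only [indicator_of_notMem (show y ∉ Ioc 0 R from fun h => hy.not_ge h.2)]
      linarith)
  rw [integral_sub' hi₁ hi₂, integral_sub (integrableOn_fermi φ 4) ((integrableOn_fermi φ 2).const_mul _),
    integral_sub (integrableOn_indicator_pow R 4) ((integrableOn_indicator_pow R 2).const_mul _),
    integral_const_mul, integral_const_mul, setIntegral_indicator_pow hR.le,
    setIntegral_indicator_pow hR.le] at hpos
  change 0 < radialMoment 4 φ - R ^ 2 * radialMoment 2 φ - _ at hpos
  rw [h] at hpos
  norm_num at hpos
  linarith

lemma varphiFD_pos (φ : ℝ) : 0 < varphiFD φ := by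
  have hp := Real.pi_pos
  have h2 := radialMoment_pos 2 φ
  have h4 := radialMoment_pos 4 φ
  rw [varphiFD_eq, momentRatio]
  positivity

lemma varphiFD_lt (φ : ℝ) : varphiFD φ < Jconst := by
  have h2 := radialMoment_pos 2 φ
  set R := (3 * radialMoment 2 φ) ^ ((1 : ℝ) / 3) with hRdef
  have hR : 0 < R := by positivity
  have hR3 : radialMoment 2 φ = R ^ 3 / 3 := by
    rw [hRdef, ← Real.rpow_natCast, ← Real.rpow_mul (by positivity)]
    norm_num
  rw [varphiFD_eq, hR3, ← momentRatio_ball hR]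
  exact momentRatio_lt (by positivity) (by positivity) (radialMoment_four_gt hR hR3)

lemma tendsto_varphiFD_atBot : Tendsto varphiFD atBot (nhds 0) := by
  have hp := Real.pi_pos
  have hA : ∀ n : ℕ, 0 < ∫ y in Ioi (0 : ℝ), y ^ n * Real.exp (-(y ^ 2 / 2)) := fun n =>
    setIntegral_Ioi_pos le_rfl (integrableOn_pow_mul_gaussian n)
      (fun y hy => by positivity) (fun y hy => by positivity)
  set A := ∫ y in Ioi (0 : ℝ), y ^ 2 * Real.exp (-(y ^ 2 / 2)) with hAdef
  set B := ∫ y in Ioi (0 : ℝ), y ^ 4 * Real.exp (-(y ^ 2 / 2)) with hBdef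
  have hA0 : 0 < A := hA 2
  have hB0 : 0 < B := hA 4
  have hlim : Tendsto (fun φ : ℝ => Real.exp (2 / 5 * φ) * momentRatio A (B / 2))
      atBot (nhds 0) := by
    rw [← zero_mul (momentRatio A (B / 2))]
    exact (Real.tendsto_exp_atBot.comp
      (tendsto_id.const_mul_atBot (by norm_num))).mul_const _
  refine squeeze_zero' (Eventually.of_forall fun φ => (varphiFD_pos φ).le) ?_ hlim
  filter_upwards [eventually_le_atBot 0] with φ hφ
  have h2 : radialMoment 2 φ ≤ Real.exp φ * A := by
    rw [hAdef, ← integral_const_mul]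
    exact setIntegral_mono_on (integrableOn_fermi φ 2)
      ((integrableOn_pow_mul_gaussian 2).const_mul _) measurableSet_Ioi
      fun y hy => fermi_le_gaussian (le_of_lt hy) φ 2
  have h4 : Real.exp φ / 2 * B ≤ radialMoment 4 φ := by
    rw [hBdef, ← integral_const_mul]
    exact setIntegral_mono_on ((integrableOn_pow_mul_gaussian 4).const_mul _)
      (integrableOn_fermi φ 4) measurableSet_Ioi
      fun y hy => gaussian_le_fermi (le_of_lt hy) hφ 4
  have h20 := radialMoment_pos 2 φ
  calc varphiFD φ = 4 * Real.pi * radialMoment 2 φ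
        / (4 * Real.pi / 3 * radialMoment 4 φ) ^ ((3 : ℝ) / 5) := varphiFD_eq φ
    _ ≤ 4 * Real.pi * (Real.exp φ * A)
        / (4 * Real.pi / 3 * (Real.exp φ / 2 * B)) ^ ((3 : ℝ) / 5) := by gcongr
    _ = Real.exp (2 / 5 * φ) * momentRatio A (B / 2) := by
      rw [momentRatio, show 4 * Real.pi / 3 * (Real.exp φ / 2 * B)
          = Real.exp φ * (4 * Real.pi / 3 * (B / 2)) by ring,
        Real.mul_rpow (by positivity) (by positivity), ← Real.exp_mul,
        show Real.exp (2 / 5 * φ) = Real.exp φ / Real.exp (φ * (3 / 5)) by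
          rw [← Real.exp_sub]; ring_nf]
      field_simp

/-- The radial moment after the substitution `y = √φ w`, without the power of `√φ`. -/
def scaledMoment (n : ℕ) (φ : ℝ) : ℝ :=
  ∫ w in Ioi (0 : ℝ), w ^ n * (1 + Real.exp (φ * (w ^ 2 / 2 - 1)))⁻¹

lemma radialMoment_eq_scaled (n : ℕ) {φ : ℝ} (hφ : 0 < φ) :
    radialMoment n φ = Real.sqrt φ ^ (n + 1) * scaledMoment n φ := by
  have hs : 0 < Real.sqrt φ := Real.sqrt_pos.2 hφ
  have h := integral_comp_mul_left_Ioi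
    (fun y : ℝ => y ^ n * (1 + Real.exp (y ^ 2 / 2 - φ))⁻¹) 0 hs
  rw [mul_zero, smul_eq_mul, eq_inv_mul_iff_mul_eq₀ hs.ne'] at h
  rw [radialMoment, ← h, pow_succ' (Real.sqrt φ) n, mul_assoc, scaledMoment]
  congr 1
  rw [← integral_const_mul]
  refine integral_congr_ae (Eventually.of_forall fun w => ?_)
  dsimp only
  rw [mul_pow, mul_pow, Real.sq_sqrt hφ.le]
  ring_nf

lemma tendsto_scaledMoment (n : ℕ) :
    Tendsto (scaledMoment n) atTop (nhds (Real.sqrt 2 ^ (n + 1) / (n + 1))) := by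
  rw [← setIntegral_indicator_pow (Real.sqrt_nonneg 2)]
  refine tendsto_integral_filter_of_dominated_convergence
    (fun w => Real.exp 1 * (w ^ n * Real.exp (-(w ^ 2 / 2)))) ?_ ?_
    ((integrableOn_pow_mul_gaussian n).const_mul _) ?_
  · refine Eventually.of_forall fun φ => Continuous.aestronglyMeasurable ?_
    refine Continuous.mul (by fun_prop) (Continuous.inv₀ (by fun_prop) fun y => ?_)
    positivity
  · filter_upwards [eventually_ge_atTop 1] with φ hφ
    filter_upwards [ae_restrict_mem measurableSet_Ioi] with w hw
    have hw : 0 < w := hw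
    rw [Real.norm_of_nonneg (by positivity)]
    have h : (1 + Real.exp (φ * (w ^ 2 / 2 - 1)))⁻¹ ≤ Real.exp (-(w ^ 2 / 2 - 1)) := by
      rcases le_total (w ^ 2 / 2 - 1) 0 with h0 | h0
      · exact (inv_le_one_of_one_le₀ (by linarith [Real.exp_pos (φ * (w ^ 2 / 2 - 1))])).trans
          (Real.one_le_exp (by linarith))
      · refine (inv_one_add_exp_le _).trans (Real.exp_le_exp.2 ?_)
        nlinarith
    rw [show -(w ^ 2 / 2 - 1) = 1 + -(w ^ 2 / 2) by ring, Real.exp_add] at h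
    calc _ ≤ w ^ n * (Real.exp 1 * Real.exp (-(w ^ 2 / 2))) := by gcongr
      _ = _ := by ring
  · filter_upwards [ae_restrict_mem measurableSet_Ioi,
      ae_restrict_of_ae (Measure.ae_ne volume (Real.sqrt 2))] with w hw hne
    have hw : 0 < w := hw
    rcases lt_or_gt_of_ne hne with hlt | hgt
    · rw [indicator_of_mem (show w ∈ Ioc 0 (Real.sqrt 2) from ⟨hw, hlt.le⟩)]
      have h0 : w ^ 2 / 2 - 1 < 0 := by
        have := (Real.lt_sqrt hw.le).1 hlt
        linarith
      have h1 := (Real.tendsto_exp_atBot.comp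
        (tendsto_id.atTop_mul_const_of_neg h0)).const_add 1
      simpa using (h1.inv₀ (by norm_num)).const_mul (w ^ n)
    · rw [indicator_of_notMem (show w ∉ Ioc 0 (Real.sqrt 2) from fun h => hgt.not_ge h.2)]
      have h0 : 0 < w ^ 2 / 2 - 1 := by
        have := (Real.sqrt_lt' hw).1 hgt
        linarith
      have h1 := tendsto_atTop_add_const_left atTop (1 : ℝ)
        (Real.tendsto_exp_atTop.comp (tendsto_id.atTop_mul_const h0))
      simpa using (tendsto_inv_atTop_zero.comp h1).const_mul (w ^ n)

lemma tendsto_varphiFD_atTop : Tendsto varphiFD atTop (nhds Jconst) := by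
  have hp := Real.pi_pos
  have h2 := tendsto_scaledMoment 2
  have h4 := tendsto_scaledMoment 4
  have hs : 0 < Real.sqrt 2 := by positivity
  have hlim : Tendsto (fun φ => momentRatio (scaledMoment 2 φ) (scaledMoment 4 φ)) atTop
      (nhds (momentRatio (Real.sqrt 2 ^ 3 / 3) (Real.sqrt 2 ^ 5 / 5))) := by
    norm_num only [Nat.cast_ofNat] at h2 h4
    refine (h2.const_mul _).div ((h4.const_mul _).rpow_const (Or.inr (by norm_num))) ?_
    positivity
  rw [momentRatio_ball hs] at hlim
  refine hlim.congr' ?_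
  filter_upwards [eventually_gt_atTop 0] with φ hφ
  have hnn : 0 ≤ scaledMoment 4 φ :=
    setIntegral_nonneg measurableSet_Ioi fun w hw => by positivity
  rw [varphiFD_eq, radialMoment_eq_scaled 2 hφ, radialMoment_eq_scaled 4 hφ,
    momentRatio_scale (Real.sqrt_pos.2 hφ) hnn]

/-- `0 < varphi(φ) < J` for every `φ`, `varphi(φ) → 0` as `φ → −∞`,
and `varphi(φ) → J` as `φ → +∞`. -/
theorem varphi_range_and_limits :
    (∀ φ : ℝ, 0 < varphiFD φ ∧ varphiFD φ < Jconst) ∧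
    Tendsto varphiFD atBot (nhds 0) ∧
    Tendsto varphiFD atTop (nhds Jconst) := by
  exact ⟨fun φ => ⟨varphiFD_pos φ, varphiFD_lt φ⟩, tendsto_varphiFD_atBot,
    tendsto_varphiFD_atTop⟩
end
end
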